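/- Let φ be a Schwartz function on ℝ, not identically zero, whose Fourier transform φ̂ is supported in [−1/100, 1/100]. For an integer N, let c_l = 1 if 9N/10 ≤ l ≤ 11N/10 and c_l = 0 otherwise, and let A_l = card{(j,k) ∈ {1,…,N}² : j + k = l}. For t ∈ [0,1] define F_{N,t}(x) = N^{−2} φ(x/N)² Σ_{l=2}^{2N} a_l(t) c_l A_l e^{2πi l x/N}, where a_l are the Rademacher functions. Then for every 0 < p < ∞ there exist constants c, C > 0 depending only on p and φ such that for all sufficiently large N: c·N^{1−p/2} ≤ ∫₀¹ ∫_ℝ |F_{N,t}(x)|^p dx dt ≤ C·N^{1−p/2}. -/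

import Mathlib

open MeasureTheory

noncomputable section

/-- The Rademacher functions `a_j(t) = sign(sin(2^j π t))`. -/
def rademacher (j : ℕ) (t : ℝ) : ℝ := Real.sign (Real.sin (2 ^ j * Real.pi * t))

/-- The one-dimensional Fourier transform `f̂(ξ) = ∫ f(y) e^{-2πi yξ} dy`. -/
def ft1 (f : ℝ → ℂ) (ξ : ℝ) : ℂ :=
  ∫ y : ℝ, f y * Complex.exp (-(2 * Real.pi * Complex.I) * ((y * ξ : ℝ) : ℂ))

/-- The coefficient `c_l`: `1` if `9N/10 ≤ l ≤ 11N/10` and `0` otherwise. -/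
def cN (N : ℕ) (l : ℕ) : ℝ :=
  if 9 * (N : ℝ) / 10 ≤ (l : ℝ) ∧ (l : ℝ) ≤ 11 * (N : ℝ) / 10 then 1 else 0

/-- `A_l = card{(j,k) ∈ {1,…,N}² : j + k = l}`. -/
def AN (N : ℕ) (l : ℕ) : ℕ :=
  ((Finset.Icc 1 N ×ˢ Finset.Icc 1 N).filter fun q => q.1 + q.2 = l).card

/-- `F_{N,t}(x) = N⁻² φ(x/N)² Σ_{l=2}^{2N} a_l(t) c_l A_l e^{2πi l x/N}`. -/
def FNt (φ : SchwartzMap ℝ ℂ) (N : ℕ) (t : ℝ) (x : ℝ) : ℂ :=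
  (((N : ℝ) ^ 2 : ℝ) : ℂ)⁻¹ * φ (x / N) ^ 2 * ∑ l ∈ Finset.Icc 2 (2 * N),
    (rademacher l t : ℂ) * (cN N l : ℂ) * (AN N l : ℂ) *
      Complex.exp ((2 * Real.pi * Complex.I) * (((l : ℝ) * x / N : ℝ) : ℂ))

lemma rad_measurable (j : ℕ) : Measurable (rademacher j) := by
  have h : Measurable Real.sign := by
    unfold Real.sign
    exact Measurable.ite measurableSet_Iio measurable_const
      (Measurable.ite measurableSet_Ioi measurable_const measurable_const)
  exact h.comp (by fun_prop)

lemma rad_abs_le (j : ℕ) (t : ℝ) : |rademacher j t| ≤ 1 := by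
  unfold rademacher
  rcases Real.sign_apply_eq (Real.sin (2 ^ j * Real.pi * t)) with h | h | h <;> rw [h] <;> simp

lemma rad_succ (j : ℕ) (t : ℝ) : rademacher (j + 1) t = rademacher j (2 * t) := by
  unfold rademacher
  congr 2; ring

lemma rad_periodic (j : ℕ) : Function.Periodic (rademacher (j + 1)) 1 := by
  intro t
  unfold rademacher
  congr 1
  have : (2:ℝ) ^ (j+1) * Real.pi * (t + 1) = 2 ^ (j+1) * Real.pi * t + ((2 ^ j : ℕ) : ℝ) * (2 * Real.pi) := by
    push_cast; ring
  rw [this, Real.sin_add_nat_mul_two_pi]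

lemma rad_one_left {t : ℝ} (h0 : 0 < t) (h1 : t < 1 / 2) : rademacher 1 t = 1 := by
  unfold rademacher
  apply Real.sign_of_pos
  apply Real.sin_pos_of_pos_of_lt_pi
  · positivity
  · nlinarith [Real.pi_pos]

lemma rad_one_right {t : ℝ} (h0 : 1 / 2 < t) (h1 : t < 1) : rademacher 1 t = -1 := by
  unfold rademacher
  apply Real.sign_of_neg
  have : (2:ℝ) ^ 1 * Real.pi * t = (2 * Real.pi * t - 2 * Real.pi) + 2 * Real.pi := by ring
  rw [this, Real.sin_add_two_pi]
  apply Real.sin_neg_of_neg_of_neg_pi_lt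
  · nlinarith [Real.pi_pos]
  · nlinarith [Real.pi_pos]

lemma ii_of_bdd {f : ℝ → ℝ} (hf : Measurable f) (B : ℝ) (hB : ∀ t, |f t| ≤ B) (a b : ℝ) :
    IntervalIntegrable f volume a b := by
  apply (intervalIntegrable_const (c := B) (μ := volume) (a := a) (b := b)).mono_fun hf.aestronglyMeasurable
  refine Filter.Eventually.of_forall fun t => ?_
  simpa using (hB t).trans (le_abs_self B)

lemma bdd_rad {g : ℝ → ℝ} (hg : Continuous g) : ∃ B, 0 ≤ B ∧ ∀ j t, |g (rademacher j t)| ≤ B := by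
  obtain ⟨B, hB⟩ := isCompact_Icc.exists_bound_of_continuousOn (s := Set.Icc (-1:ℝ) 1) hg.continuousOn
  refine ⟨|B|, abs_nonneg _, fun j t => ?_⟩
  have := hB (rademacher j t) (by have := rad_abs_le j t; rw [abs_le] at this; exact this)
  exact this.trans (le_abs_self B)

lemma prod_formula (n : ℕ) : ∀ g : ℕ → ℝ → ℝ, (∀ j, Continuous (g j)) →
    ∫ t in (0:ℝ)..1, ∏ j ∈ Finset.range n, g j (rademacher (j + 1) t) =
      ∏ j ∈ Finset.range n, (g j 1 + g j (-1)) / 2 := by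
  induction n with
  | zero => intro g _; simp
  | succ n ih =>
    intro g hg
    set H : ℝ → ℝ := fun t => ∏ j ∈ Finset.range n, g (j + 1) (rademacher (j + 1) t) with hH
    have ihH : ∫ t in (0:ℝ)..1, H t = _ := ih (fun j => g (j+1)) (fun j => hg _)
    have hHm : Measurable H := by
      apply Finset.measurable_prod
      intro j _
      exact (hg _).measurable.comp (rad_measurable _)
    choose B hB0 hB using fun j => bdd_rad (hg j)
    have hHb : ∀ t, |H t| ≤ ∏ j ∈ Finset.range n, B (j+1) := by
      intro t
      rw [hH]; simp only []
      rw [Finset.abs_prod]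
      exact Finset.prod_le_prod (fun _ _ => abs_nonneg _) (fun j _ => hB _ _ _)
    have hper : Function.Periodic H 1 := by
      intro t
      simp only [hH]
      refine Finset.prod_congr rfl fun j _ => ?_
      rw [rad_periodic j t]
    have hii : ∀ a b c : ℝ, IntervalIntegrable (fun t => c * H (2 * t)) volume a b := by
      intro a b c
      exact (ii_of_bdd (hHm.comp (measurable_const_mul 2)) _ (fun t => hHb _) a b).const_mul c
    have hs : (fun t => ∏ j ∈ Finset.range (n+1), g j (rademacher (j + 1) t)) =
        fun t => g 0 (rademacher 1 t) * H (2 * t) := by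
      funext t
      rw [Finset.prod_range_succ', mul_comm]
      simp only [hH, zero_add]
      congr 1
      refine Finset.prod_congr rfl fun j _ => ?_
      rw [rad_succ]
    rw [hs]
    have e1 : Set.EqOn (fun t => g 0 1 * H (2 * t)) (fun t => g 0 (rademacher 1 t) * H (2 * t)) (Set.uIoo (0:ℝ) (1/2)) := by
      intro t ht
      rw [Set.uIoo_of_lt (by norm_num)] at ht
      simp only []
      rw [rad_one_left ht.1 ht.2]
    have e2 : Set.EqOn (fun t => g 0 (-1) * H (2 * t)) (fun t => g 0 (rademacher 1 t) * H (2 * t)) (Set.uIoo (1/2:ℝ) 1) := by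
      intro t ht
      rw [Set.uIoo_of_lt (by norm_num)] at ht
      simp only []
      rw [rad_one_right ht.1 ht.2]
    have i1 := (hii 0 (1/2) (g 0 1)).congr_uIoo e1
    have i2 := (hii (1/2) 1 (g 0 (-1))).congr_uIoo e2
    rw [← intervalIntegral.integral_add_adjacent_intervals i1 i2,
      ← intervalIntegral.integral_congr_uIoo e1, ← intervalIntegral.integral_congr_uIoo e2,
      intervalIntegral.integral_const_mul, intervalIntegral.integral_const_mul,
      intervalIntegral.integral_comp_mul_left _ (by norm_num), 
      intervalIntegral.integral_comp_mul_left _ (by norm_num)]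
    have hp2 := hper.intervalIntegral_add_eq 1 0
    norm_num at hp2 ⊢
    rw [hp2, ihH, Finset.prod_range_succ']
    simp
    ring

def RX (n : ℕ) (r : ℕ → ℝ) (t : ℝ) : ℝ := ∑ j ∈ Finset.range n, rademacher (j + 1) t * r j

def SC (n : ℕ) (z : ℕ → ℂ) (t : ℝ) : ℂ := ∑ j ∈ Finset.range n, (rademacher (j + 1) t : ℂ) * z j

lemma RX_meas (n : ℕ) (r : ℕ → ℝ) : Measurable (RX n r) := by
  unfold RX
  exact Finset.measurable_sum _ fun j _ => (rad_measurable _).mul_const _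

lemma SC_meas (n : ℕ) (z : ℕ → ℂ) : Measurable (SC n z) := by
  unfold SC
  exact Finset.measurable_sum _ fun j _ =>
    (Complex.measurable_ofReal.comp (rad_measurable _)).mul_const _

lemma SC_bdd (n : ℕ) (z : ℕ → ℂ) (t : ℝ) : ‖SC n z t‖ ≤ ∑ j ∈ Finset.range n, ‖z j‖ := by
  unfold SC
  refine (norm_sum_le _ _).trans (Finset.sum_le_sum fun j _ => ?_)
  rw [norm_mul, Complex.norm_real]
  exact mul_le_of_le_one_left (norm_nonneg _) (rad_abs_le _ _)

lemma RX_bdd (n : ℕ) (r : ℕ → ℝ) (t : ℝ) : |RX n r t| ≤ ∑ j ∈ Finset.range n, |r j| := by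
  unfold RX
  refine (Finset.abs_sum_le_sum_abs _ _).trans (Finset.sum_le_sum fun j _ => ?_)
  rw [abs_mul]
  exact mul_le_of_le_one_left (abs_nonneg _) (rad_abs_le _ _)

lemma SC_re (n : ℕ) (z : ℕ → ℂ) (t : ℝ) : (SC n z t).re = RX n (fun j => (z j).re) t := by
  simp [SC, RX]

lemma SC_im (n : ℕ) (z : ℕ → ℂ) (t : ℝ) : (SC n z t).im = RX n (fun j => (z j).im) t := by
  simp [SC, RX]

lemma ii_comp_RX (n : ℕ) (r : ℕ → ℝ) {g : ℝ → ℝ} (hg : Continuous g) (a b : ℝ) :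
    IntervalIntegrable (fun t => g (RX n r t)) volume a b := by
  set D := ∑ j ∈ Finset.range n, |r j|
  obtain ⟨B, hB⟩ := isCompact_Icc.exists_bound_of_continuousOn (s := Set.Icc (-D) D) hg.continuousOn
  refine ii_of_bdd (hg.measurable.comp (RX_meas n r)) B (fun t => ?_) a b
  exact hB _ (abs_le.1 (RX_bdd n r t))

lemma ii_comp_SC (n : ℕ) (z : ℕ → ℂ) {g : ℝ → ℝ} (hg : Continuous g) (a b : ℝ) :
    IntervalIntegrable (fun t => g ‖SC n z t‖) volume a b := by
  set D := ∑ j ∈ Finset.range n, ‖z j‖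
  obtain ⟨B, hB⟩ := isCompact_Icc.exists_bound_of_continuousOn (s := Set.Icc (-D) D) hg.continuousOn
  refine ii_of_bdd (hg.measurable.comp (SC_meas n z).norm) B (fun t => ?_) a b
  have := SC_bdd n z t
  exact hB _ ⟨by linarith [norm_nonneg (SC n z t), (norm_nonneg (SC n z t)).trans this], this⟩

lemma mgf_RX (n : ℕ) (r : ℕ → ℝ) :
    ∫ t in (0:ℝ)..1, Real.exp (RX n r t) ≤ Real.exp ((∑ j ∈ Finset.range n, r j ^ 2) / 2) := by
  have h := prod_formula n (fun j x => Real.exp (x * r j)) (fun j => by fun_prop)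
  simp only [← Real.exp_sum] at h
  unfold RX
  rw [h, Finset.sum_div, Real.exp_sum]
  refine Finset.prod_le_prod (fun j _ => by positivity) fun j _ => ?_
  have := Real.cosh_le_exp_half_sq (r j)
  rw [Real.cosh_eq] at this
  simpa using this

lemma rad_orth (n i j : ℕ) (hi : i < n) (hj : j < n) :
    ∫ t in (0:ℝ)..1, rademacher (i + 1) t * rademacher (j + 1) t = if i = j then 1 else 0 := by
  have h := prod_formula n (fun k x => (if k = i then x else 1) * (if k = j then x else 1))
    (fun k => by split_ifs <;> fun_prop)
  simp only [Finset.prod_mul_distrib, Finset.prod_ite_eq', Finset.mem_range, hi, hj, if_true] at h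
  rw [h]
  split_ifs with hij
  · subst hij
    refine Finset.prod_eq_one fun k _ => ?_
    split_ifs <;> norm_num
  · refine Finset.prod_eq_zero (Finset.mem_range.2 hi) ?_
    simp [hij]

lemma second_RX (n : ℕ) (r : ℕ → ℝ) :
    ∫ t in (0:ℝ)..1, (RX n r t) ^ 2 = ∑ j ∈ Finset.range n, r j ^ 2 := by
  have : ∀ t, (RX n r t) ^ 2 = ∑ i ∈ Finset.range n, ∑ j ∈ Finset.range n,
      (r i * r j) * (rademacher (i + 1) t * rademacher (j + 1) t) := by
    intro t
    unfold RX
    rw [sq, Finset.sum_mul_sum]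
    refine Finset.sum_congr rfl fun i _ => Finset.sum_congr rfl fun j _ => by ring
  simp only [this]
  have hii : ∀ i j : ℕ, IntervalIntegrable
      (fun t => (r i * r j) * (rademacher (i + 1) t * rademacher (j + 1) t)) volume 0 1 := by
    intro i j
    refine (ii_of_bdd ((rad_measurable _).mul (rad_measurable _)) 1 (fun t => ?_) 0 1).const_mul _
    rw [Pi.mul_apply, abs_mul]
    exact mul_le_one₀ (rad_abs_le _ _) (abs_nonneg _) (rad_abs_le _ _)
  rw [intervalIntegral.integral_finsetSum (fun i _ => by
    have := IntervalIntegrable.sum (Finset.range n) (fun j _ => hii i j)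
    simpa [Finset.sum_fn] using this)]
  refine Finset.sum_congr rfl fun i hi => ?_
  rw [intervalIntegral.integral_finsetSum (fun j _ => hii i j)]
  rw [Finset.sum_congr rfl (g := fun j => if i = j then r i * r j else 0)]
  · rw [Finset.sum_ite_eq]; simp only [hi, if_true]; ring
  · intro j hj
    rw [intervalIntegral.integral_const_mul, rad_orth n i j (Finset.mem_range.1 hi) (Finset.mem_range.1 hj)]
    split_ifs <;> simp

lemma norm_sq_re_im (w : ℂ) : ‖w‖ ^ 2 = w.re ^ 2 + w.im ^ 2 := by
  rw [Complex.sq_norm, Complex.normSq_apply]; ring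

lemma second_SC (n : ℕ) (z : ℕ → ℂ) :
    ∫ t in (0:ℝ)..1, ‖SC n z t‖ ^ 2 = ∑ j ∈ Finset.range n, ‖z j‖ ^ 2 := by
  simp only [norm_sq_re_im, SC_re, SC_im]
  rw [intervalIntegral.integral_add (ii_comp_RX n _ (g := fun x => x ^ 2) (by fun_prop) 0 1)
    (ii_comp_RX n _ (g := fun x => x ^ 2) (by fun_prop) 0 1), second_RX, second_RX,
    Finset.sum_add_distrib]

lemma rpow_le_exp (p : ℝ) (hp : 0 < p) : ∃ C : ℝ, 0 < C ∧ ∀ y : ℝ, 0 ≤ y → y ^ p ≤ C * Real.exp y := by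
  obtain ⟨n, hn⟩ := exists_nat_ge p
  refine ⟨1 + n.factorial, by positivity, fun y hy => ?_⟩
  have h1 : y ^ p ≤ 1 + y ^ n := by
    rcases le_total y 1 with h | h
    · have := Real.rpow_le_one hy h hp.le
      have : 0 ≤ y ^ n := by positivity
      linarith
    · have := Real.rpow_le_rpow_of_exponent_le h hn
      rw [Real.rpow_natCast] at this
      linarith
  have h2 := Real.pow_div_factorial_le_exp y hy n
  rw [div_le_iff₀ (by positivity)] at h2
  have h3 := Real.one_le_exp hy
  nlinarith

lemma khin_upper (p : ℝ) (hp : 0 < p) : ∃ C : ℝ, 0 < C ∧ ∀ (n : ℕ) (z : ℕ → ℂ),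
    0 < ∑ j ∈ Finset.range n, ‖z j‖ ^ 2 →
    ∫ t in (0:ℝ)..1, ‖SC n z t‖ ^ p ≤ C * (∑ j ∈ Finset.range n, ‖z j‖ ^ 2) ^ (p / 2) := by
  obtain ⟨C, hC, hCb⟩ := rpow_le_exp p hp
  refine ⟨4 * C * Real.exp 2, by positivity, fun n z hz => ?_⟩
  set V := ∑ j ∈ Finset.range n, ‖z j‖ ^ 2 with hV
  set σ := Real.sqrt V with hσ
  have hσ0 : 0 < σ := Real.sqrt_pos.2 hz
  have hσ2 : σ ^ 2 = V := Real.sq_sqrt hz.le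
  have hσp : V ^ (p / 2) = σ ^ p := by
    rw [hσ, Real.sqrt_eq_rpow, ← Real.rpow_mul hz.le]; congr 1; ring
  have key : ∀ s : ℝ, (s = 2 / σ ∨ s = - (2 / σ)) → ∀ q : ℂ → ℝ, (∀ w, q w ^ 2 ≤ ‖w‖ ^ 2) →
      ∫ t in (0:ℝ)..1, Real.exp (s * RX n (fun j => q (z j)) t) ≤ Real.exp 2 := by
    intro s hs q hq
    have e : ∀ t, s * RX n (fun j => q (z j)) t = RX n (fun j => s * q (z j)) t := by
      intro t; unfold RX; rw [Finset.mul_sum]; exact Finset.sum_congr rfl fun j _ => by ring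
    simp only [e]
    refine (mgf_RX _ _).trans (Real.exp_le_exp.2 ?_)
    have hs2 : s ^ 2 = 4 / V := by
      rw [← hσ2]; rcases hs with rfl | rfl <;> field_simp <;> norm_num
    simp only [mul_pow]
    rw [← Finset.mul_sum, hs2]
    have : ∑ j ∈ Finset.range n, q (z j) ^ 2 ≤ V := Finset.sum_le_sum fun j _ => hq _
    rw [div_mul_eq_mul_div, div_div, div_le_iff₀ (by positivity)]
    linarith
  have hre : ∀ w : ℂ, w.re ^ 2 ≤ ‖w‖ ^ 2 := fun w => by rw [norm_sq_re_im]; nlinarith [sq_nonneg w.im]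
  have him : ∀ w : ℂ, w.im ^ 2 ≤ ‖w‖ ^ 2 := fun w => by rw [norm_sq_re_im]; nlinarith [sq_nonneg w.re]
  have k1 := key _ (Or.inl rfl) _ hre
  have k2 := key _ (Or.inr rfl) _ hre
  have k3 := key _ (Or.inl rfl) _ him
  have k4 := key _ (Or.inr rfl) _ him
  have i1 : ∀ (s : ℝ) (r : ℕ → ℝ), IntervalIntegrable (fun t => Real.exp (s * RX n r t)) volume 0 1 :=
    fun s r => ii_comp_RX n r (g := fun x => Real.exp (s * x)) (by fun_prop) 0 1
  have pw : ∀ t, ‖SC n z t‖ ^ p ≤ σ ^ p * C *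
      (((Real.exp (2 / σ * RX n (fun j => (z j).re) t) + Real.exp (-(2 / σ) * RX n (fun j => (z j).re) t)) +
      Real.exp (2 / σ * RX n (fun j => (z j).im) t)) + Real.exp (-(2 / σ) * RX n (fun j => (z j).im) t)) := by
    intro t
    rw [← SC_re, ← SC_im]
    set w := SC n z t
    have h1 := hCb (‖w‖ / σ) (by positivity)
    rw [Real.div_rpow (norm_nonneg _) hσ0.le, div_le_iff₀ (by positivity)] at h1
    have h2 : ‖w‖ / σ ≤ max (|2 / σ * w.re|) (|2 / σ * w.im|) := by
      rw [abs_mul, abs_mul, abs_of_pos (by positivity : 0 < 2 / σ), ← mul_max_of_nonneg _ _ (by positivity),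
        div_mul_eq_mul_div]
      gcongr
      have := Complex.norm_le_abs_re_add_abs_im w
      linarith [le_max_left |w.re| |w.im|, le_max_right |w.re| |w.im|]
    have h3 : ∀ x : ℝ, Real.exp |x| ≤ Real.exp x + Real.exp (-x) := by
      intro x
      rcases abs_choice x with h | h <;> rw [h] <;> linarith [Real.exp_pos x, Real.exp_pos (-x)]
    have h4 : Real.exp (‖w‖ / σ) ≤ Real.exp |2 / σ * w.re| + Real.exp |2 / σ * w.im| := by
      rcases le_max_iff.1 h2 with h | h <;>
        linarith [Real.exp_le_exp.2 h, Real.exp_pos |2 / σ * w.re|, Real.exp_pos |2 / σ * w.im|]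
    have h5 := h3 (2 / σ * w.re)
    have h6 := h3 (2 / σ * w.im)
    rw [neg_mul, neg_mul]
    calc ‖w‖ ^ p ≤ σ ^ p * C * Real.exp (‖w‖ / σ) := by linarith
      _ ≤ _ := by
        gcongr
        linarith
  have I1 := (i1 (2 / σ) (fun j => (z j).re)).add (i1 (-(2 / σ)) (fun j => (z j).re))
  have I2 := I1.add (i1 (2 / σ) (fun j => (z j).im))
  have I3 := I2.add (i1 (-(2 / σ)) (fun j => (z j).im))
  have := intervalIntegral.integral_mono_on (zero_le_one' ℝ)
    (ii_comp_SC n z (g := fun x => x ^ p) (Real.continuous_rpow_const hp.le) 0 1)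
    (I3.const_mul (σ ^ p * C)) (fun t _ => pw t)
  refine this.trans ?_
  rw [intervalIntegral.integral_const_mul, intervalIntegral.integral_add I2 (i1 _ _),
    intervalIntegral.integral_add I1 (i1 _ _), intervalIntegral.integral_add (i1 _ _) (i1 _ _), hσp]
  calc _ ≤ σ ^ p * C * (Real.exp 2 + Real.exp 2 + Real.exp 2 + Real.exp 2) := by
        gcongr
    _ = _ := by ring

lemma khin_lower (p : ℝ) (hp : 0 < p) : ∃ c : ℝ, 0 < c ∧ ∀ (n : ℕ) (z : ℕ → ℂ),
    0 < ∑ j ∈ Finset.range n, ‖z j‖ ^ 2 →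
    c * (∑ j ∈ Finset.range n, ‖z j‖ ^ 2) ^ (p / 2) ≤ ∫ t in (0:ℝ)..1, ‖SC n z t‖ ^ p := by
  obtain ⟨K, hK, hKb⟩ := khin_upper 4 (by norm_num)
  set d : ℝ := (1 / 4 : ℝ) ^ (p / 2) with hd
  have hd0 : 0 < d := by positivity
  refine ⟨d / (2 * K) * (1 / 4), by positivity, fun n z hz => ?_⟩
  have h4 := hKb n z hz
  have h2 := second_SC n z
  set V := ∑ j ∈ Finset.range n, ‖z j‖ ^ 2 with hV
  have e4 : (4:ℝ) / 2 = (2 : ℕ) := by norm_num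
  have e4' : (4:ℝ) = (4 : ℕ) := by norm_num
  rw [e4] at h4
  rw [e4'] at h4
  simp only [Real.rpow_natCast] at h4
  have pw : ∀ t, V ^ (p / 2) * (d / (2 * K)) * (((1 / V) * ‖SC n z t‖ ^ 2 - (1 / (2 * K * V ^ 2)) * ‖SC n z t‖ ^ 4) - 1 / 4)
      ≤ ‖SC n z t‖ ^ p := by
    intro t
    set w := ‖SC n z t‖ with hw
    have hw0 : 0 ≤ w := norm_nonneg _
    set y := w ^ 2 / V with hy
    have hy0 : 0 ≤ y := by positivity
    have e1 : (1 / V) * w ^ 2 - (1 / (2 * K * V ^ 2)) * w ^ 4 - 1 / 4 = y - y ^ 2 / (2 * K) - 1 / 4 := by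
      rw [hy]; field_simp
    have e2 : w ^ p = V ^ (p / 2) * y ^ (p / 2) := by
      rw [← Real.mul_rpow hz.le hy0, hy, mul_div_cancel₀ _ hz.ne', ← Real.rpow_natCast, ← Real.rpow_mul hw0]
      congr 1; push_cast; ring
    rw [e1, e2, mul_assoc]
    gcongr
    rcases le_or_gt (y - y ^ 2 / (2 * K) - 1 / 4) 0 with h | h
    · exact (mul_nonpos_of_nonneg_of_nonpos (by positivity) h).trans (by positivity)
    · have hq : 0 ≤ y ^ 2 / (2 * K) := by positivity
      have hy4 : 1 / 4 ≤ y := by linarith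
      have hyK : y ≤ 2 * K := by
        by_contra hc
        push Not at hc
        have : y ≤ y ^ 2 / (2 * K) := by
          rw [le_div_iff₀ (by positivity)]; nlinarith
        linarith
      calc d / (2 * K) * (y - y ^ 2 / (2 * K) - 1 / 4) ≤ d / (2 * K) * (2 * K) := by
            gcongr; linarith
        _ = d := by field_simp
        _ ≤ y ^ (p / 2) := by rw [hd]; gcongr
  have j2 := ii_comp_SC n z (g := fun x => (1 / V) * x ^ 2) (by fun_prop) 0 1
  have j4 := ii_comp_SC n z (g := fun x => (1 / (2 * K * V ^ 2)) * x ^ 4) (by fun_prop) 0 1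
  have := intervalIntegral.integral_mono_on (zero_le_one' ℝ)
    (((j2.sub j4).sub (intervalIntegrable_const (c := (1/4:ℝ)))).const_mul (V ^ (p / 2) * (d / (2 * K))))
    (ii_comp_SC n z (g := fun x => x ^ p) (Real.continuous_rpow_const hp.le) 0 1) (fun t _ => pw t)
  refine le_trans ?_ this
  rw [intervalIntegral.integral_const_mul, intervalIntegral.integral_sub (j2.sub j4) intervalIntegrable_const,
    intervalIntegral.integral_sub j2 j4, intervalIntegral.integral_const_mul, intervalIntegral.integral_const_mul, h2]
  have h5 : (1 / (2 * K * V ^ 2)) * ∫ t in (0:ℝ)..1, ‖SC n z t‖ ^ 4 ≤ 1 / 2 := by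
    calc _ ≤ (1 / (2 * K * V ^ 2)) * (K * V ^ 2) := by gcongr
      _ = 1 / 2 := by field_simp
  have h6 : (1 / V) * V = 1 := by field_simp
  rw [h6]
  have : (1:ℝ) / 4 ≤ 1 - (1 / (2 * K * V ^ 2)) * (∫ t in (0:ℝ)..1, ‖SC n z t‖ ^ 4) - ∫ t in (0:ℝ)..1, (1/4 : ℝ) := by
    rw [intervalIntegral.integral_const]
    simp only [smul_eq_mul]
    linarith
  calc _ = V ^ (p / 2) * (d / (2 * K)) * (1 / 4) := by ring
    _ ≤ _ := by gcongr

def zz (N : ℕ) (x : ℝ) (j : ℕ) : ℂ := (cN N (j + 1) : ℂ) * (AN N (j + 1) : ℂ) *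
      Complex.exp ((2 * Real.pi * Complex.I) * ((((j + 1 : ℕ) : ℝ) * x / N : ℝ) : ℂ))

def VN (N : ℕ) : ℝ := ∑ j ∈ Finset.range (2 * N), (cN N (j + 1) * AN N (j + 1)) ^ 2

lemma cN_nonneg (N l : ℕ) : 0 ≤ cN N l := by unfold cN; split_ifs <;> norm_num
lemma cN_le (N l : ℕ) : cN N l ≤ 1 := by unfold cN; split_ifs <;> norm_num

lemma zz_norm (N : ℕ) (x : ℝ) (j : ℕ) : ‖zz N x j‖ = cN N (j + 1) * AN N (j + 1) := by
  unfold zz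
  rw [norm_mul, norm_mul, Complex.norm_real, Complex.norm_natCast, Real.norm_of_nonneg (cN_nonneg _ _)]
  have : (2 * Real.pi * Complex.I) * ((((j + 1 : ℕ) : ℝ) * x / N : ℝ) : ℂ) =
      ((2 * Real.pi * (((j + 1 : ℕ) : ℝ) * x / N) : ℝ) : ℂ) * Complex.I := by push_cast; ring
  rw [this, Complex.norm_exp_ofReal_mul_I, mul_one]

lemma zz_sum (N : ℕ) (x : ℝ) : ∑ j ∈ Finset.range (2 * N), ‖zz N x j‖ ^ 2 = VN N := by
  simp only [zz_norm, VN]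

lemma AN_one (N : ℕ) : AN N 1 = 0 := by
  unfold AN
  rw [Finset.card_eq_zero, Finset.filter_eq_empty_iff]
  rintro ⟨a, b⟩ h
  simp only [Finset.mem_product, Finset.mem_Icc] at h ⊢
  omega

lemma AN_le (N l : ℕ) : AN N l ≤ N := by
  unfold AN
  have : (Finset.Icc 1 N).card = N := by simp
  conv_rhs => rw [← this]
  refine Finset.card_le_card_of_injOn Prod.fst ?_ ?_
  · intro q hq
    simp only [Finset.coe_filter, Finset.mem_product, Set.mem_ofPred_eq] at hq
    exact hq.1.1
  · rintro ⟨a, b⟩ h1 ⟨a', b'⟩ h2 h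
    simp only [Finset.coe_filter, Finset.mem_product, Set.mem_ofPred_eq] at h1 h2 h
    simp only [Prod.mk.injEq]
    omega

lemma AN_ge (N l : ℕ) (hl : l + 1 ≤ N) : l ≤ AN N (l + 1) := by
  unfold AN
  have : (Finset.Icc 1 l).card = l := by simp
  conv_lhs => rw [← this]
  refine Finset.card_le_card_of_injOn (fun a => (a, l + 1 - a)) ?_ ?_
  · intro a ha
    simp only [Finset.coe_Icc, Set.mem_Icc] at ha
    simp only [Finset.coe_filter, Finset.mem_product, Set.mem_ofPred_eq, Finset.mem_Icc]
    omega
  · intro a _ b _ h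
    simp only [Prod.mk.injEq] at h
    exact h.1

lemma VN_le (N : ℕ) : VN N ≤ 2 * (N : ℝ) ^ 3 := by
  unfold VN
  calc _ ≤ ∑ j ∈ Finset.range (2 * N), (1 * (N : ℝ)) ^ 2 := by
        refine Finset.sum_le_sum fun j _ => ?_
        have h1 := cN_nonneg N (j + 1)
        have h2 := cN_le N (j + 1)
        have h3 : (AN N (j + 1) : ℝ) ≤ N := by exact_mod_cast AN_le N (j + 1)
        gcongr
    _ = _ := by rw [Finset.sum_const, Finset.card_range, nsmul_eq_mul]; push_cast; ring

lemma VN_ge (N : ℕ) (hN : 10 ≤ N) : (N : ℝ) ^ 3 / 40 ≤ VN N := by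
  unfold VN
  have hsub : Finset.Ico (N - 1 - N / 10) N ⊆ Finset.range (2 * N) := by
    intro j hj
    simp only [Finset.mem_Ico, Finset.mem_range] at hj ⊢
    omega
  refine le_trans ?_ (Finset.sum_le_sum_of_subset_of_nonneg hsub fun _ _ _ => sq_nonneg _)
  calc (N : ℝ) ^ 3 / 40 ≤ ((N / 10 + 1 : ℕ) : ℝ) * ((N : ℝ) / 2) ^ 2 := by
        have : (N : ℝ) / 10 ≤ ((N / 10 + 1 : ℕ) : ℝ) := by
          rw [div_le_iff₀ (by norm_num)]
          exact_mod_cast (by omega : N ≤ (N / 10 + 1) * 10)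
        calc (N : ℝ) ^ 3 / 40 = (N : ℝ) / 10 * ((N : ℝ) / 2) ^ 2 := by ring
          _ ≤ _ := by gcongr
    _ = ∑ j ∈ Finset.Ico (N - 1 - N / 10) N, ((N : ℝ) / 2) ^ 2 := by
        rw [Finset.sum_const, Nat.card_Ico, nsmul_eq_mul]
        congr 3
        omega
    _ ≤ _ := by
        refine Finset.sum_le_sum fun j hj => ?_
        rw [Finset.mem_Ico] at hj
        have h1 : cN N (j + 1) = 1 := by
          unfold cN
          rw [if_pos]
          constructor
          · rw [div_le_iff₀ (by norm_num)]
            exact_mod_cast (by omega : 9 * N ≤ (j + 1) * 10)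
          · rw [le_div_iff₀ (by norm_num)]
            exact_mod_cast (by omega : (j + 1) * 10 ≤ 11 * N)
        rw [h1, one_mul]
        have h2 := AN_ge N j (by omega)
        have h3 : (N : ℝ) / 2 ≤ AN N (j + 1) := by
          rw [div_le_iff₀ (by norm_num)]
          exact_mod_cast (by omega : N ≤ AN N (j + 1) * 2)
        gcongr

lemma FNt_eq (φ : SchwartzMap ℝ ℂ) (N : ℕ) (hN : 1 ≤ N) (t x : ℝ) :
    FNt φ N t x = (((N : ℝ) ^ 2 : ℝ) : ℂ)⁻¹ * φ (x / N) ^ 2 * SC (2 * N) (zz N x) t := by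
  unfold FNt SC zz
  congr 1
  set f : ℕ → ℂ := fun l => (rademacher l t : ℂ) * (cN N l : ℂ) * (AN N l : ℂ) *
      Complex.exp ((2 * Real.pi * Complex.I) * (((l : ℝ) * x / N : ℝ) : ℂ)) with hf
  have e : ∀ j, (rademacher (j + 1) t : ℂ) * ((cN N (j + 1) : ℂ) * (AN N (j + 1) : ℂ) *
      Complex.exp ((2 * Real.pi * Complex.I) * ((((j + 1 : ℕ) : ℝ) * x / N : ℝ) : ℂ))) = f (j + 1) := by
    intro j; simp only [hf]; ring
  simp only [e]
  obtain ⟨m, hm⟩ : ∃ m, 2 * N = m + 1 := ⟨2 * N - 1, by omega⟩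
  rw [hm, Finset.sum_range_succ']
  have f1 : f (0 + 1) = 0 := by simp [hf, AN_one]
  rw [f1, add_zero]
  refine (Finset.sum_bij (fun j _ => j + 2) ?_ ?_ ?_ ?_).symm
  · intro a ha; simp only [Finset.mem_range, Finset.mem_Icc] at ha ⊢; omega
  · intro a _ b _ h; omega
  · intro b hb
    simp only [Finset.mem_range, Finset.mem_Icc] at hb ⊢
    exact ⟨b - 2, by omega, by omega⟩
  · intro a _; rfl

lemma FNt_norm (φ : SchwartzMap ℝ ℂ) (N : ℕ) (hN : 1 ≤ N) (t x : ℝ) (p : ℝ) :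
    ‖FNt φ N t x‖ ^ p = ((N : ℝ) ^ (-2 * p) * ‖φ (x / N)‖ ^ (2 * p)) * ‖SC (2 * N) (zz N x) t‖ ^ p := by
  rw [FNt_eq φ N hN, norm_mul, norm_mul, norm_inv, Complex.norm_real, norm_pow, norm_pow,
    Real.mul_rpow (by positivity) (by positivity), Real.mul_rpow (by positivity) (by positivity)]
  congr 2
  · rw [Real.norm_of_nonneg (by positivity), Real.inv_rpow (by positivity), ← Real.rpow_natCast,
      ← Real.rpow_mul (by positivity), ← Real.rpow_neg (by positivity)]
    congr 1; push_cast; ring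
  · rw [← Real.rpow_natCast, ← Real.rpow_mul (by positivity)]
    congr 1

lemma SCzz_meas (N : ℕ) : Measurable (fun q : ℝ × ℝ => SC (2 * N) (zz N q.2) q.1) := by
  unfold SC zz
  refine Finset.measurable_sum _ fun j _ => ?_
  have : Measurable (fun q : ℝ × ℝ => (rademacher (j + 1) q.1 : ℂ)) :=
    (Complex.measurable_ofReal.comp (rad_measurable (j + 1))).comp measurable_fst
  refine Measurable.mul this ?_
  fun_prop

/-- **Khinchine-type estimate for `T_N(f_N,g_N)`.** If `φ` is a nonzero Schwartz function
with `φ̂` supported in `[-1/100, 1/100]`, then for `0 < p < ∞`, for all sufficiently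
large `N`, `∫₀¹∫_ℝ |F_{N,t}(x)|^p dx dt ≈ N^{1-p/2}`, with constants depending only on
`p` and `φ`. -/
theorem FN_Lp_estimate (φ : SchwartzMap ℝ ℂ) (hφ_ne : φ ≠ 0)
    (hφ_supp : ∀ ξ : ℝ, ft1 (⇑φ) ξ ≠ 0 → |ξ| ≤ 1 / 100)
    (p : ℝ) (hp : 0 < p) :
    ∃ c C : ℝ, 0 < c ∧ 0 < C ∧ ∃ N₀ : ℕ, ∀ N : ℕ, N₀ ≤ N →
      c * (N : ℝ) ^ (1 - p / 2) ≤
        (∫ t in Set.Icc (0 : ℝ) 1, ∫ x : ℝ, ‖FNt φ N t x‖ ^ p) ∧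
      (∫ t in Set.Icc (0 : ℝ) 1, ∫ x : ℝ, ‖FNt φ N t x‖ ^ p) ≤
        C * (N : ℝ) ^ (1 - p / 2) := by
  have hΦi : Integrable (fun y : ℝ => ‖φ y‖ ^ (2 * p)) := by
    have := (φ.memLp (ENNReal.ofReal (2 * p))).integrable_norm_rpow
      (by simpa using hp) ENNReal.ofReal_ne_top
    rwa [ENNReal.toReal_ofReal (by positivity)] at this
  have hIpos : 0 < ∫ y : ℝ, ‖φ y‖ ^ (2 * p) := by
    obtain ⟨y, hy⟩ : ∃ y, φ y ≠ 0 := by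
      by_contra h
      push Not at h
      exact hφ_ne (by ext y; simpa using h y)
    refine integral_pos_of_integrable_nonneg_nonzero (x := y) ?_ hΦi (fun y => by positivity) ?_
    · exact φ.continuous.norm.rpow_const fun _ => Or.inr (by positivity)
    · have : 0 < ‖φ y‖ := norm_pos_iff.2 hy
      positivity
  set I := ∫ y : ℝ, ‖φ y‖ ^ (2 * p) with hI
  obtain ⟨C, hC, hCb⟩ := khin_upper p hp
  obtain ⟨c, hc, hcb⟩ := khin_lower p hp
  refine ⟨c * (1 / 40) ^ (p / 2) * I, C * 2 ^ (p / 2) * I, by positivity, by positivity, 10,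
    fun N hN => ?_⟩
  have hN0 : (0 : ℝ) < N := by exact_mod_cast (by omega : 0 < N)
  have hV1 := VN_ge N hN
  have hV2 := VN_le N
  have hV0 : 0 < VN N := lt_of_lt_of_le (by positivity) hV1
  set Φ : ℝ → ℝ := fun x => (N : ℝ) ^ (-2 * p) * ‖φ (x / N)‖ ^ (2 * p) with hΦ
  have hΦint : Integrable Φ := (hΦi.comp_div hN0.ne').const_mul _
  have hΦI : ∫ x, Φ x = (N : ℝ) ^ (-2 * p) * (N * I) := by
    simp only [hΦ]
    rw [integral_const_mul, Measure.integral_comp_div (fun y => ‖φ y‖ ^ (2 * p)), abs_of_pos hN0, smul_eq_mul]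
  set B : ℝ := ∑ j ∈ Finset.range (2 * N), cN N (j + 1) * AN N (j + 1) with hB
  have hF : ∀ t x, ‖FNt φ N t x‖ ^ p = Φ x * ‖SC (2 * N) (zz N x) t‖ ^ p :=
    fun t x => FNt_norm φ N (by omega) t x p
  simp only [hF]
  have hFint : Integrable (Function.uncurry fun t x => Φ x * ‖SC (2 * N) (zz N x) t‖ ^ p)
      ((volume.restrict (Set.Icc (0:ℝ) 1)).prod volume) := by
    have hdom := (hΦint.comp_snd (volume.restrict (Set.Icc (0:ℝ) 1))).mul_const (B ^ p)
    refine hdom.mono ?_ (Filter.Eventually.of_forall ?_)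
    · have hφm : Measurable φ := φ.continuous.measurable
      have h1 : Measurable Φ := by simp only [hΦ]; fun_prop
      exact ((h1.comp measurable_snd).mul ((SCzz_meas N).norm.pow_const p)).aestronglyMeasurable
    · rintro ⟨t, x⟩
      have hΦ0 : 0 ≤ Φ x := by simp only [hΦ]; positivity
      have hb := SC_bdd (2 * N) (zz N x) t
      simp only [zz_norm] at hb
      have hB0 : 0 ≤ B := (norm_nonneg _).trans hb
      simp only [Function.uncurry]
      rw [Real.norm_of_nonneg (by positivity), Real.norm_of_nonneg (by positivity)]
      gcongr
  rw [integral_integral_swap hFint]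
  have hr : Integrable (fun x => ∫ t in Set.Icc (0:ℝ) 1, Φ x * ‖SC (2 * N) (zz N x) t‖ ^ p) :=
    hFint.integral_prod_right
  have hin : ∀ x, ∫ t in Set.Icc (0:ℝ) 1, Φ x * ‖SC (2 * N) (zz N x) t‖ ^ p =
      Φ x * ∫ t in (0:ℝ)..1, ‖SC (2 * N) (zz N x) t‖ ^ p := by
    intro x
    rw [integral_const_mul, integral_Icc_eq_integral_Ioc, intervalIntegral.integral_of_le zero_le_one]
  simp only [hin] at hr ⊢
  have hΦ0 : ∀ x, 0 ≤ Φ x := fun x => by simp only [hΦ]; positivity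
  have hpow : (N : ℝ) ^ (-2 * p) * (N * I) * ((N : ℝ) ^ 3) ^ (p / 2) = I * (N : ℝ) ^ (1 - p / 2) := by
    have h3 : ((N : ℝ) ^ 3) ^ (p / 2) = (N : ℝ) ^ (3 * (p / 2)) := by
      rw [← Real.rpow_natCast, ← Real.rpow_mul hN0.le]; norm_num
    have : (N : ℝ) ^ (1 - p / 2) = (N : ℝ) ^ (-2 * p) * N * (N : ℝ) ^ (3 * (p / 2)) := by
      conv_rhs => rw [← Real.rpow_add_one hN0.ne', ← Real.rpow_add hN0]
      congr 1; ring
    rw [this, h3]; ring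
  have hP0 : 0 ≤ (N : ℝ) ^ (-2 * p) * (N * I) := by positivity
  constructor
  · calc c * (1 / 40) ^ (p / 2) * I * (N : ℝ) ^ (1 - p / 2)
        = (N : ℝ) ^ (-2 * p) * (N * I) * (c * ((N : ℝ) ^ 3 / 40) ^ (p / 2)) := by
          rw [show (N : ℝ) ^ 3 / 40 = 1 / 40 * (N : ℝ) ^ 3 by ring, Real.mul_rpow (by norm_num) (by positivity)]
          linear_combination (-c * (1 / 40) ^ (p / 2)) * hpow
      _ ≤ (N : ℝ) ^ (-2 * p) * (N * I) * (c * (VN N) ^ (p / 2)) := by gcongr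
      _ = ∫ x, Φ x * (c * (VN N) ^ (p / 2)) := by rw [integral_mul_const, hΦI]
      _ ≤ _ := by
          refine integral_mono (hΦint.mul_const _) hr fun x => ?_
          have := hcb (2 * N) (zz N x) (by rw [zz_sum]; exact hV0)
          rw [zz_sum] at this
          exact mul_le_mul_of_nonneg_left this (hΦ0 x)
  · calc _ ≤ ∫ x, Φ x * (C * (VN N) ^ (p / 2)) := by
          refine integral_mono hr (hΦint.mul_const _) fun x => ?_
          have := hCb (2 * N) (zz N x) (by rw [zz_sum]; exact hV0)
          rw [zz_sum] at this
          exact mul_le_mul_of_nonneg_left this (hΦ0 x)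
      _ = (N : ℝ) ^ (-2 * p) * (N * I) * (C * (VN N) ^ (p / 2)) := by rw [integral_mul_const, hΦI]
      _ ≤ (N : ℝ) ^ (-2 * p) * (N * I) * (C * (2 * (N : ℝ) ^ 3) ^ (p / 2)) := by gcongr
      _ = _ := by
          rw [Real.mul_rpow (by norm_num) (by positivity)]
          linear_combination (C * 2 ^ (p / 2)) * hpow

end
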